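/- (Well-definedness of primitive length) Any two primitive generators of the same word c̄ have equal length; hence the primitive length of c̄ (defined as the length of any primitive generator of c̄) is well defined. Moreover, the primitive length of c̄ is at most |c̄|. -/

import Mathlib

/-- A function `f : {1,…,m} → {1,…,k}` (0-indexed here) is adjacent if the
indices of consecutive values differ by at most 1. -/
def Adjacent {m k : ℕ} (f : Fin m → Fin k) : Prop :=
  ∀ (i : ℕ) (h : i + 1 < m),
    |(((f ⟨i + 1, h⟩ : Fin k) : ℕ) : ℤ) - (((f ⟨i, Nat.lt_of_succ_lt h⟩ : Fin k) : ℕ) : ℤ)| ≤ 1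

/-- A word `a` generates a word `c` if `c = a^f` for some surjective adjacent `f`. -/
def Generates {A : Type*} (a c : List A) : Prop :=
  ∃ f : Fin c.length → Fin a.length,
    Adjacent f ∧ Function.Surjective f ∧ c = List.ofFn (fun i => a.get (f i))

/-- A word is primitive if it is not generated by any strictly shorter word. -/
def Primitive {A : Type*} (a : List A) : Prop :=
  ¬ ∃ b : List A, b.length < a.length ∧ Generates b a

/-- A primitive generator of `c` is a generator of `c` that is primitive. -/
def PrimitiveGenerator {A : Type*} (a c : List A) : Prop :=
  Primitive a ∧ Generates a c

/-- The word `c` is symmetric about position `s` up to distance `r`. -/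
def PalindromicAt {B : Type*} (c : ℤ → B) (s r : ℤ) : Prop :=
  ∀ j, 0 ≤ j → j ≤ r → c (s - j) = c (s + j)

/-- `g` moves by at most one at each step of `[0, n)`. -/
def IsWalk (n : ℤ) (g : ℤ → ℤ) : Prop :=
  ∀ i, 0 ≤ i → i + 1 < n → g (i + 1) ≤ g i + 1 ∧ g i ≤ g (i + 1) + 1

/-- The walk `g` exhibits the word `c` on `[0, n)` as generated by the word `b` on `[0, k)`. -/
structure IsFolding {B : Type*} (b : ℤ → B) (k : ℤ) (c : ℤ → B) (n : ℤ) (g : ℤ → ℤ) : Prop where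
  range : ∀ i, 0 ≤ i → i < n → 0 ≤ g i ∧ g i < k
  surj : ∀ y, 0 ≤ y → y < k → ∃ i, 0 ≤ i ∧ i < n ∧ g i = y
  walk : IsWalk n g
  label : ∀ i, 0 ≤ i → i < n → c i = b (g i)

/-- The word `c` on `[0, n)` has two equal consecutive letters. -/
def HasStutter {B : Type*} (c : ℤ → B) (n : ℤ) : Prop :=
  ∃ i, 0 ≤ i ∧ i + 1 < n ∧ c i = c (i + 1)

/-- The word `c` on `[0, n)` can be shortened by folding away a prefix of length `r`, a suffix of
length `r`, or a zigzag with legs of length `r`. -/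
def HasFold {B : Type*} (c : ℤ → B) (n r : ℤ) : Prop :=
  1 ≤ r ∧ ((2 * r < n ∧ PalindromicAt c r r) ∨ (2 * r < n ∧ PalindromicAt c (n - 1 - r) r) ∨
    ∃ t, r ≤ t ∧ t + 2 * r < n ∧ PalindromicAt c t r ∧ PalindromicAt c (t + r) r)

/-- The word `c` on `[0, n)` has neither stutters nor folds. -/
def FoldFree {B : Type*} (c : ℤ → B) (n : ℤ) : Prop :=
  ¬ HasStutter c n ∧ ∀ r, ¬ HasFold c n r

/-- The walk `g` on `[0, n)` reverses direction at `s`. -/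
def IsTurn (n : ℤ) (g : ℤ → ℤ) (s : ℤ) : Prop :=
  0 < s ∧ s + 1 < n ∧ g (s - 1) = g (s + 1)

theorem IsWalk.exists_eq {n : ℤ} {g : ℤ → ℤ} (hg : IsWalk n g) {i j v : ℤ} (hi : 0 ≤ i)
    (hin : i < n) (hj : 0 ≤ j) (hjn : j < n) (hiv : g i ≤ v) (hvj : v ≤ g j) :
    ∃ m, 0 ≤ m ∧ m < n ∧ g m = v := by
  by_contra! hne
  have up : ∀ d : ℕ, i + d < n → g (i + d) < v := by
    intro d
    induction d with
    | zero =>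
      intro _
      have := hne i hi hin
      simp only [Nat.cast_zero, add_zero]
      omega
    | succ d ih =>
      intro hd
      push_cast at hd ⊢
      have h1 := ih (by omega)
      have h2 := hg (i + d) (by omega) (by omega)
      have h3 := hne (i + d + 1) (by omega) (by omega)
      rw [← add_assoc]
      omega
  have down : ∀ d : ℕ, 0 ≤ i - d → g (i - d) < v := by
    intro d
    induction d with
    | zero =>
      intro _
      have := hne i hi hin
      simp only [Nat.cast_zero, sub_zero]
      omega
    | succ d ih =>
      intro hd
      push_cast at hd ⊢
      have h1 := ih (by omega)
      have h2 := hg (i - (d + 1)) (by omega) (by omega)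
      have h3 := hne (i - (d + 1)) (by omega) (by omega)
      rw [show i - ((d : ℤ) + 1) + 1 = i - d by ring] at h2
      omega
  rcases le_total i j with h | h
  · have := up (j - i).toNat (by omega)
    rw [show i + ((j - i).toNat : ℤ) = j by omega] at this
    omega
  · have := down (i - j).toNat (by omega)
    rw [show i - ((i - j).toNat : ℤ) = j by omega] at this
    omega

/-- If a walk covers `[0, k)` except possibly for a leg from `y` to `y + ε * p` whose end it
visits, then it covers `[0, k)`, unless `y` is an unvisited end of `[0, k)`. -/
theorem IsWalk.surj_or_end {n k y ε p : ℤ} {g : ℤ → ℤ} (hg : IsWalk n g) (hε : ε = 1 ∨ ε = -1)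
    (hp : 0 ≤ p) (hy : 0 ≤ y) (hyk : y < k)
    (hcover : ∀ v, 0 ≤ v → v < k →
      (∃ i, 0 ≤ i ∧ i < n ∧ g i = v) ∨ ∃ j, 0 ≤ j ∧ j ≤ p ∧ v = y + ε * j)
    (hend : ∃ i, 0 ≤ i ∧ i < n ∧ g i = y + ε * p) :
    (∀ v, 0 ≤ v → v < k → ∃ i, 0 ≤ i ∧ i < n ∧ g i = v) ∨
      ((ε = 1 ∧ y = 0 ∨ ε = -1 ∧ y = k - 1) ∧ ∀ i, 0 ≤ i → i < n → g i ≠ y) := by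
  obtain ⟨e, he, hen, hge⟩ := hend
  by_cases hvis : ∃ i, 0 ≤ i ∧ i < n ∧ g i = y
  · left
    obtain ⟨i, hi, hin, hgi⟩ := hvis
    intro v hv hvk
    rcases hcover v hv hvk with h | ⟨j, hj, hjp, rfl⟩
    · exact h
    · rcases hε with rfl | rfl
      · exact hg.exists_eq hi hin he hen (by omega) (by omega)
      · exact hg.exists_eq he hen hi hin (by omega) (by omega)
  · right
    refine ⟨?_, fun i hi hin h => hvis ⟨i, hi, hin, h⟩⟩
    rcases hε with rfl | rfl
    · left
      refine ⟨rfl, ?_⟩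
      by_contra hne
      rcases hcover 0 le_rfl (by omega) with ⟨i, hi, hin, h⟩ | ⟨j, hj, hjp, h⟩
      · exact hvis (hg.exists_eq hi hin he hen (by omega) (by omega))
      · omega
    · right
      refine ⟨rfl, ?_⟩
      by_contra hne
      rcases hcover (k - 1) (by omega) (by omega) with ⟨i, hi, hin, h⟩ | ⟨j, hj, hjp, h⟩
      · exact hvis (hg.exists_eq he hen hi hin (by omega) (by omega))
      · omega

theorem IsFolding.step {B : Type*} {b c : ℤ → B} {k n : ℤ} {g : ℤ → ℤ}
    (hg : IsFolding b k c n g) (hc : ¬ HasStutter c n) {i : ℤ} (hi : 0 ≤ i) (hin : i + 1 < n) :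
    g (i + 1) = g i + 1 ∨ g (i + 1) = g i - 1 := by
  have h1 := hg.walk i hi hin
  have h2 : g i ≠ g (i + 1) := fun h => hc ⟨i, hi, hin, by
    rw [hg.label i hi (by omega), hg.label (i + 1) (by omega) hin, h]⟩
  omega

/-- Between turns, a walk without stutters is straight. -/
theorem IsFolding.straight {B : Type*} {b c : ℤ → B} {k n : ℤ} {g : ℤ → ℤ}
    (hg : IsFolding b k c n g) (hc : ¬ HasStutter c n) {lo hi : ℤ} (hlo : 0 ≤ lo) (hhi : hi < n)
    (hturn : ∀ s, lo < s → s < hi → ¬ IsTurn n g s) :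
    ∃ ε : ℤ, (ε = 1 ∨ ε = -1) ∧ ∀ i, lo ≤ i → i ≤ hi → g i = g lo + ε * (i - lo) := by
  by_cases hlt : lo < hi
  · have key : ∀ ε : ℤ, (ε = 1 ∨ ε = -1) → g (lo + 1) = g lo + ε →
        ∀ d : ℕ, lo + d + 1 ≤ hi →
          g (lo + d) = g lo + ε * d ∧ g (lo + d + 1) = g lo + ε * (d + 1) := by
      intro ε hε h0 d
      induction d with
      | zero => intro _; simp [h0]
      | succ d ih =>
        intro hd
        push_cast at hd ⊢
        obtain ⟨h1, h2⟩ := ih (by omega)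
        have h3 := hturn (lo + d + 1) (by omega) (by omega)
        have h4 := hg.step hc (i := lo + d + 1) (by omega) (by omega)
        have h5 : g (lo + d) ≠ g (lo + d + 1 + 1) := fun h =>
          h3 ⟨by omega, by omega, by rwa [show lo + (d : ℤ) + 1 - 1 = lo + d by ring]⟩
        rw [← add_assoc]
        rcases hε with rfl | rfl <;> omega
    have fin : ∀ ε : ℤ, (ε = 1 ∨ ε = -1) → g (lo + 1) = g lo + ε →
        ∀ i, lo ≤ i → i ≤ hi → g i = g lo + ε * (i - lo) := by
      intro ε hε h0 i hi1 hi2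
      by_cases h : i = lo
      · simp [h]
      · have := (key ε hε h0 (i - lo - 1).toNat (by omega)).2
        rw [show lo + ((i - lo - 1).toNat : ℤ) + 1 = i by omega,
          show ((i - lo - 1).toNat : ℤ) + 1 = i - lo by omega] at this
        exact this
    rcases hg.step hc hlo (by omega) with h | h
    · exact ⟨1, Or.inl rfl, fin 1 (Or.inl rfl) h⟩
    · exact ⟨-1, Or.inr rfl, fin (-1) (Or.inr rfl) (by omega)⟩
  · refine ⟨1, Or.inl rfl, fun i h1 h2 => ?_⟩
    obtain rfl : i = lo := by omega
    simp

/-- If `c` has no folds smaller than `p`, then all legs of a walk generating `c` have length at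
least `p`. -/
theorem IsFolding.legs {B : Type*} {b c : ℤ → B} {k n : ℤ} {g : ℤ → ℤ}
    (hg : IsFolding b k c n g) (hc : ¬ HasStutter c n) (p : ℕ)
    (hmin : ∀ r : ℤ, r < p → ¬ HasFold c n r) {s : ℤ} (hs : IsTurn n g s) :
    p ≤ s ∧ s + p < n ∧ ∃ ε : ℤ, (ε = 1 ∨ ε = -1) ∧
      ∀ j : ℤ, 0 ≤ j → j ≤ p → g (s - j) = g s + ε * j ∧ g (s + j) = g s + ε * j := by
  induction p generalizing s with
  | zero =>
    obtain ⟨h1, h2, -⟩ := hs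
    refine ⟨by simpa using h1.le, by push_cast; omega, 1, Or.inl rfl, fun j hj hjp => ?_⟩
    obtain rfl : j = 0 := by push_cast at hjp; omega
    simp
  | succ p ih =>
    push_cast at hmin ⊢
    have ih' := fun {s} => @ih (fun r hr => hmin r (by omega)) s
    obtain ⟨hps, hsn, ε, hε, hleg⟩ := ih' hs
    obtain ⟨h0, h1, heq⟩ := hs
    have hpal : ∀ s, IsTurn n g s → PalindromicAt c s p := by
      intro s hs j hj hjp
      obtain ⟨hps, hsn, ε, -, hleg⟩ := ih' hs
      rw [hg.label _ (by omega) (by omega), hg.label _ (by omega) (by omega),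
        (hleg j hj hjp).1, (hleg j hj hjp).2]
    by_cases hp : p = 0
    · subst hp
      refine ⟨by push_cast; omega, by push_cast; omega, g (s + 1) - g s, ?_, ?_⟩
      · have := hg.step hc h0.le h1
        omega
      · intro j hj hjp
        obtain rfl | rfl : j = 0 ∨ j = 1 := by push_cast at hjp; omega
        · simp
        · exact ⟨by rw [heq]; ring, by ring⟩
    have hfold := hmin p (by omega)
    have hsp : s ≠ p := fun h =>
      hfold ⟨by omega, Or.inl ⟨by omega, h ▸ hpal s ⟨h0, h1, heq⟩⟩⟩
    have hsn' : s ≠ n - 1 - p := fun h =>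
      hfold ⟨by omega, Or.inr (Or.inl ⟨by omega, h ▸ hpal s ⟨h0, h1, heq⟩⟩)⟩
    have hzig : ∀ t, IsTurn n g t → ¬ IsTurn n g (t + p) := fun t ht ht' =>
      hfold ⟨by omega, Or.inr (Or.inr ⟨t, (ih' ht).1, by have := (ih' ht').2.1; omega,
        hpal t ht, hpal _ ht'⟩)⟩
    refine ⟨by omega, by omega, ε, hε, fun j hj hjp => ?_⟩
    by_cases hjp' : j ≤ p
    · exact hleg j hj hjp'
    obtain rfl : j = p + 1 := by omega
    have l1 := hleg p (by omega) le_rfl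
    have l2 := hleg (p - 1) (by omega) (by omega)
    have r1 := hg.step hc (i := s + p) (by omega) (by omega)
    have r2 := hg.step hc (i := s - (p + 1)) (by omega) (by omega)
    have n1 : g (s + (p - 1)) ≠ g (s + p + 1) := fun h =>
      hzig s ⟨h0, h1, heq⟩ ⟨by omega, by omega, by rwa [show s + (p : ℤ) - 1 = s + (p - 1) by ring]⟩
    have n2 : g (s - (p + 1)) ≠ g (s - (p - 1)) := fun h =>
      hzig (s - p) ⟨by omega, by omega, by
        rwa [show s - (p : ℤ) - 1 = s - (p + 1) by ring,
          show s - (p : ℤ) + 1 = s - (p - 1) by ring]⟩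
        (by rw [sub_add_cancel]; exact ⟨h0, h1, heq⟩)
    rw [show s - ((p : ℤ) + 1) + 1 = s - p by ring] at r2
    rw [← add_assoc]
    rcases hε with rfl | rfl <;> omega

/-- Near a palindromic centre of radius `p`, a walk can only turn at that centre, provided there
are no folds smaller than `p`. -/
theorem IsFolding.not_isTurn_near {B : Type*} {b c : ℤ → B} {k n : ℤ} {g : ℤ → ℤ}
    (hg : IsFolding b k c n g) (hc : ¬ HasStutter c n) {p : ℕ}
    (hmin : ∀ r : ℤ, r < p → ¬ HasFold c n r) {s t : ℤ} (hpt : p ≤ t) (htn : t + p < n)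
    (ht : PalindromicAt c t p) (h1 : t - p < s) (h2 : s < t + p) (hne : s ≠ t) :
    ¬ IsTurn n g s := by
  intro hs
  obtain ⟨hps, hsn, ε, -, hleg⟩ := hg.legs hc p hmin hs
  have hpal : PalindromicAt c s p := by
    intro j hj hjp
    rw [hg.label _ (by omega) (by omega), hg.label _ (by omega) (by omega),
      (hleg j hj hjp).1, (hleg j hj hjp).2]
  rcases lt_or_gt_of_ne hne with h | h
  · refine hmin (t - s) (by omega) ⟨by omega, Or.inr (Or.inr ⟨s, by omega, by omega,
      fun j hj hjp => hpal j hj (by omega), fun j hj hjp => ?_⟩)⟩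
    rw [add_sub_cancel]
    exact ht j hj (by omega)
  · refine hmin (s - t) (by omega) ⟨by omega, Or.inr (Or.inr ⟨t, by omega, by omega,
      fun j hj hjp => ht j hj (by omega), fun j hj hjp => ?_⟩)⟩
    rw [add_sub_cancel]
    exact hpal j hj (by omega)

/-- A palindromic centre that is traversed straight yields one in the generating word. -/
theorem IsFolding.palindromicAt {B : Type*} {b c : ℤ → B} {k n : ℤ} {g : ℤ → ℤ}
    (hg : IsFolding b k c n g) {t p ε : ℤ} (hε : ε = 1 ∨ ε = -1) (hpt : p ≤ t) (htn : t + p < n)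
    (ht : PalindromicAt c t p)
    (hst : ∀ j, -p ≤ j → j ≤ p → g (t + j) = g t + ε * j) : PalindromicAt b (g t) p := by
  intro j hj hjp
  have h := ht j hj hjp
  rw [hg.label _ (by omega) (by omega), hg.label _ (by omega) (by omega), hst j (by omega) hjp,
    sub_eq_add_neg, hst (-j) (by omega) (by omega)] at h
  rcases hε with rfl | rfl
  · convert h using 2 <;> ring
  · convert h.symm using 2 <;> ring

/-- A fold-free word is only generated by words of its own length. -/
theorem IsFolding.length_eq {B : Type*} {b c : ℤ → B} {k n : ℤ} {g : ℤ → ℤ}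
    (hg : IsFolding b k c n g) (hn : 0 < n) (hc : FoldFree c n) : k = n := by
  obtain ⟨ε, hε, hst⟩ := hg.straight hc.1 (lo := 0) (hi := n - 1) le_rfl (by omega)
    (fun s h1 h2 hs => by
      have := (hg.legs hc.1 n.toNat (fun r _ => hc.2 r) hs).2.1
      omega)
  have h0 := hg.range 0 le_rfl hn
  have h1 := hg.range (n - 1) (by omega) (by omega)
  have h2 := hst (n - 1) (by omega) le_rfl
  obtain ⟨i, hi, hin, hgi⟩ := hg.surj 0 le_rfl (by omega)
  obtain ⟨j, hj, hjn, hgj⟩ := hg.surj (k - 1) (by omega) (by omega)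
  have h3 := hst i hi (by omega)
  have h4 := hst j hj (by omega)
  rcases hε with rfl | rfl <;> omega

theorem HasStutter.exists_isFolding {B : Type*} {b : ℤ → B} {k : ℤ} (h : HasStutter b k) :
    ∃ d m h, 0 ≤ m ∧ m < k ∧ IsFolding d m b k h := by
  obtain ⟨t, ht, htk, heq⟩ := h
  refine ⟨fun i => if i ≤ t then b i else b (i + 1), k - 1,
    fun i => if i ≤ t then i else i - 1, by omega, by omega, ?_, ?_, ?_, ?_⟩
  · intro i hi hik
    split_ifs <;> omega
  · intro y hy hyk
    by_cases h : y ≤ t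
    · exact ⟨y, by omega, by omega, by simp [h]⟩
    · exact ⟨y + 1, by omega, by omega, by rw [if_neg (by omega)]; ring⟩
  · intro i hi hik
    dsimp only
    split_ifs <;> omega
  · intro i hi hik
    by_cases h : i ≤ t
    · simp [h]
    · rw [if_neg h]
      split_ifs with h'
      · obtain rfl : i = t + 1 := by omega
        rw [← heq]; congr 1; ring
      · congr 1; ring

theorem HasFold.exists_isFolding {B : Type*} {b : ℤ → B} {k r : ℤ} (h : HasFold b k r) :
    ∃ d m h, 0 ≤ m ∧ m < k ∧ IsFolding d m b k h := by
  obtain ⟨hr, ⟨hrk, hpal⟩ | ⟨hrk, hpal⟩ | ⟨t, hrt, htk, hpal, hpal'⟩⟩ := h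
  · refine ⟨fun i => b (i + r), k - r, fun i => if i ≤ r then r - i else i - r, by omega,
      by omega, ?_, ?_, ?_, ?_⟩
    · intro i hi hik
      split_ifs <;> omega
    · intro y hy hyk
      exact ⟨y + r, by omega, by omega, by split_ifs <;> omega⟩
    · intro i hi hik
      dsimp only
      split_ifs <;> omega
    · intro i hi hik
      split_ifs with h
      · have := hpal (r - i) (by omega) (by omega)
        rw [sub_sub_cancel] at this
        rw [this]; congr 1; ring
      · congr 1; ring
  · refine ⟨b, k - r, fun i => if i ≤ k - 1 - r then i else 2 * (k - 1 - r) - i, by omega,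
      by omega, ?_, ?_, ?_, ?_⟩
    · intro i hi hik
      split_ifs <;> omega
    · intro y hy hyk
      exact ⟨y, by omega, by omega, by split_ifs <;> omega⟩
    · intro i hi hik
      dsimp only
      split_ifs <;> omega
    · intro i hi hik
      split_ifs with h
      · rfl
      · have := hpal (i - (k - 1 - r)) (by omega) (by omega)
        rw [add_sub_cancel] at this
        rw [← this]; congr 1; ring
  · have per : ∀ i, t + r ≤ i → i ≤ t + 2 * r → b i = b (i - 2 * r) := by
      intro i h1 h2
      have e1 := hpal' (i - (t + r)) (by omega) (by omega)
      have e2 := hpal (t + 2 * r - i) (by omega) (by omega)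
      rw [show t + r + (i - (t + r)) = i by ring] at e1
      rw [← e1, show t + r - (i - (t + r)) = t + (t + 2 * r - i) by ring, ← e2]
      congr 1; ring
    refine ⟨fun i => if i ≤ t then b i else b (i + 2 * r), k - 2 * r,
      fun i => if i ≤ t then i else if i ≤ t + r then 2 * t - i else i - 2 * r, by omega,
      by omega, ?_, ?_, ?_, ?_⟩
    · intro i hi hik
      split_ifs <;> omega
    · intro y hy hyk
      by_cases h : y ≤ t
      · exact ⟨y, by omega, by omega, by simp [h]⟩
      · exact ⟨y + 2 * r, by omega, by omega, by split_ifs <;> omega⟩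
    · intro i hi hik
      dsimp only
      split_ifs <;> omega
    · intro i hi hik
      by_cases h : i ≤ t
      · simp [h]
      · by_cases h' : i ≤ t + r
        · have := hpal (i - t) (by omega) (by omega)
          rw [add_sub_cancel] at this
          rw [if_neg h, if_pos h', if_pos (by omega), ← this]
          congr 1; ring
        · rw [if_neg h, if_neg h']
          split_ifs with h''
          · exact per i (by omega) (by omega)
          · congr 1; ring

theorem IsFolding.collapse_stutter {B : Type*} {b c : ℤ → B} {k n : ℤ} {g : ℤ → ℤ}
    (hg : IsFolding b k c n g) (hb : FoldFree b k) {t : ℤ} (ht : 0 ≤ t) (htn : t + 1 < n)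
    (heq : c t = c (t + 1)) :
    ∃ g', IsFolding b k (fun i => if i ≤ t then c i else c (i + 1)) (n - 1) g' := by
  have hgt : g t = g (t + 1) := by
    by_contra hne
    have h1 := hg.walk t ht htn
    have h2 := hg.range t ht (by omega)
    have h3 := hg.range (t + 1) (by omega) htn
    rw [hg.label t ht (by omega), hg.label (t + 1) (by omega) htn] at heq
    obtain h | h : g (t + 1) = g t + 1 ∨ g t = g (t + 1) + 1 := by omega
    · exact hb.1 ⟨g t, by omega, by omega, by rw [heq, h]⟩
    · exact hb.1 ⟨g (t + 1), by omega, by omega, by rw [← heq, h]⟩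
  refine ⟨fun i => if i ≤ t then g i else g (i + 1), ?_, ?_, ?_, ?_⟩
  · intro i hi hin
    split_ifs
    · exact hg.range i hi (by omega)
    · exact hg.range (i + 1) (by omega) (by omega)
  · intro y hy hyk
    obtain ⟨i, hi, hin, rfl⟩ := hg.surj y hy hyk
    by_cases h : i ≤ t
    · exact ⟨i, by omega, by omega, by simp [h]⟩
    · by_cases h' : i = t + 1
      · exact ⟨t, by omega, by omega, by simp [h', hgt]⟩
      · exact ⟨i - 1, by omega, by omega, by rw [if_neg (by omega), sub_add_cancel]⟩
  · intro i hi hin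
    dsimp only
    by_cases h : i ≤ t
    · by_cases h' : i = t
      · subst h'
        have := hg.walk (i + 1) (by omega) (by omega)
        rw [if_neg (by omega), if_pos h]
        omega
      · rw [if_pos (by omega), if_pos h]
        exact hg.walk i hi (by omega)
    · rw [if_neg (by omega), if_neg h]
      exact hg.walk (i + 1) (by omega) (by omega)
  · intro i hi hin
    split_ifs
    · exact hg.label i hi (by omega)
    · exact hg.label (i + 1) (by omega) (by omega)

theorem IsFolding.collapse_start {B : Type*} {b c : ℤ → B} {k n : ℤ} {g : ℤ → ℤ}
    (hg : IsFolding b k c n g) (hb : FoldFree b k) (hc : ¬ HasStutter c n) {p : ℕ} (hp : 1 ≤ p)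
    (hmin : ∀ r : ℤ, r < p → ¬ HasFold c n r) (hpn : 2 * (p : ℤ) < n)
    (hpal : PalindromicAt c p p) :
    ∃ g', IsFolding b k (fun i => c (i + p)) (n - p) g' := by
  have hwalk : IsWalk (n - p) (fun i => g (i + p)) := fun i hi hin => by
    have := hg.walk (i + p) (by omega) (by omega)
    rwa [add_right_comm] at this
  obtain ⟨ε, hε, hst⟩ := hg.straight hc (lo := 0) (hi := p) le_rfl (by omega)
    (fun s h1 h2 => hg.not_isTurn_near hc hmin le_rfl (by omega) hpal (by omega) (by omega)
      (by omega))
  have h0 := hg.range 0 le_rfl (by omega)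
  have hsurj := hwalk.surj_or_end (k := k) (y := g 0) (p := p) hε (by omega) h0.1 h0.2
    (fun v hv hvk => by
      obtain ⟨i, hi, hin, rfl⟩ := hg.surj v hv hvk
      by_cases h : i < p
      · exact Or.inr ⟨i, hi, h.le, by rw [hst i hi h.le, sub_zero]⟩
      · exact Or.inl ⟨i - p, by omega, by omega, by simp⟩)
    ⟨0, le_rfl, by omega, by
      have := hst p (by omega) le_rfl
      simpa using this⟩
  refine ⟨fun i => g (i + p), fun i hi hin => hg.range _ (by omega) (by omega), ?_, hwalk,
    fun i hi hin => hg.label _ (by omega) (by omega)⟩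
  refine hsurj.resolve_right ?_
  rintro ⟨hy, hvis⟩
  by_cases hturn : IsTurn n g p
  · obtain ⟨-, -, ε', -, hleg⟩ := hg.legs hc p hmin hturn
    obtain ⟨e1, e2⟩ := hleg p (by omega) le_rfl
    refine hvis p (by omega) (by omega) ?_
    rw [e2, ← e1, sub_self]
  · obtain ⟨ε', hε', hst'⟩ := hg.straight hc (lo := 0) (hi := 2 * p) le_rfl hpn
      (fun s h1 h2 hs => by
        by_cases h : s = p
        · exact hturn (h ▸ hs)
        · exact hg.not_isTurn_near hc hmin le_rfl (by omega) hpal (by omega) (by omega) h hs)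
    have e0 := hst' p (by omega) (by omega)
    have e1 := hst p (by omega) le_rfl
    have e2 := hg.range (2 * p) (by omega) hpn
    have e3 := hst' (2 * p) (by omega) le_rfl
    have hpb := hg.palindromicAt hε' le_rfl (by omega) hpal
      (fun j h1 h2 => by rw [hst' _ (by omega) (by omega), e0]; ring)
    rcases hy with ⟨rfl, hy⟩ | ⟨rfl, hy⟩
    · refine hb.2 p ⟨by omega, Or.inl ⟨?_, ?_⟩⟩
      · rcases hε' with rfl | rfl <;> omega
      · rwa [show g p = p by omega] at hpb
    · refine hb.2 p ⟨by omega, Or.inr (Or.inl ⟨?_, ?_⟩)⟩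
      · rcases hε' with rfl | rfl <;> omega
      · rwa [show g p = k - 1 - p by omega] at hpb

theorem PalindromicAt.reverse {B : Type*} {c : ℤ → B} {s r : ℤ} (h : PalindromicAt c s r) (n : ℤ) :
    PalindromicAt (fun i => c (n - 1 - i)) (n - 1 - s) r := fun j hj hjr => by
  have := (h j hj hjr).symm
  dsimp only
  convert this using 2 <;> ring

theorem HasFold.reverse {B : Type*} {c : ℤ → B} {n r : ℤ} (h : HasFold c n r) :
    HasFold (fun i => c (n - 1 - i)) n r := by
  obtain ⟨hr, ⟨hrn, hpal⟩ | ⟨hrn, hpal⟩ | ⟨t, hrt, htn, hpal, hpal'⟩⟩ := h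
  · exact ⟨hr, Or.inr (Or.inl ⟨hrn, hpal.reverse n⟩)⟩
  · refine ⟨hr, Or.inl ⟨hrn, ?_⟩⟩
    simpa using hpal.reverse n
  · refine ⟨hr, Or.inr (Or.inr ⟨n - 1 - (t + r), by omega, by omega, hpal'.reverse n, ?_⟩)⟩
    rw [show n - 1 - (t + r) + r = n - 1 - t by ring]
    exact hpal.reverse n

theorem HasStutter.reverse {B : Type*} {c : ℤ → B} {n : ℤ} (h : HasStutter c n) :
    HasStutter (fun i => c (n - 1 - i)) n := by
  obtain ⟨i, hi, hin, heq⟩ := h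
  refine ⟨n - 1 - (i + 1), by omega, by omega, ?_⟩
  dsimp only
  convert heq.symm using 2 <;> ring

theorem IsFolding.reverse {B : Type*} {b c : ℤ → B} {k n : ℤ} {g : ℤ → ℤ}
    (hg : IsFolding b k c n g) :
    IsFolding b k (fun i => c (n - 1 - i)) n (fun i => g (n - 1 - i)) := by
  refine ⟨fun i hi hin => hg.range _ (by omega) (by omega), ?_, ?_,
    fun i hi hin => hg.label _ (by omega) (by omega)⟩
  · intro y hy hyk
    obtain ⟨i, hi, hin, rfl⟩ := hg.surj y hy hyk
    exact ⟨n - 1 - i, by omega, by omega, by simp⟩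
  · intro i hi hin
    have := hg.walk (n - 1 - (i + 1)) (by omega) (by omega)
    rw [show n - 1 - (i + 1) + 1 = n - 1 - i by ring] at this
    exact this.symm

/-- A walk through a zigzag can be shortened at a turn of the walk. -/
theorem IsFolding.collapse_zigzag_of_isTurn {B : Type*} {b c : ℤ → B} {k n : ℤ} {g : ℤ → ℤ}
    (hg : IsFolding b k c n g) (hb : FoldFree b k) (hc : ¬ HasStutter c n) {p : ℕ} (hp : 1 ≤ p)
    (hmin : ∀ r : ℤ, r < p → ¬ HasFold c n r) {t : ℤ} (htn : t + 2 * p < n)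
    (hpal' : PalindromicAt c (t + p) p) (hturn : IsTurn n g t) :
    ∃ g', IsFolding b k (fun i => if i < t - p then c i else c (i + 2 * p)) (n - 2 * p) g' := by
  obtain ⟨hpt, -, ε, hε, hleg⟩ := hg.legs hc p hmin hturn
  have hends : g (t - p) = g (t + p) := by
    rw [(hleg p (by omega) le_rfl).1, (hleg p (by omega) le_rfl).2]
  set g' : ℤ → ℤ := fun i => if i < t - p then g i else g (i + 2 * p) with hg'
  have hwalk : IsWalk (n - 2 * p) g' := by
    intro i hi hin
    rw [hg']
    dsimp only
    by_cases h : i < t - p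
    · have := hg.walk i hi (by omega)
      by_cases h' : i + 1 < t - p
      · rwa [if_pos h, if_pos h']
      · rw [if_pos h, if_neg h', show i + 1 + 2 * (p : ℤ) = t + p by omega, ← hends,
          show t - (p : ℤ) = i + 1 by omega]
        exact this
    · rw [if_neg h, if_neg (by omega)]
      have := hg.walk (i + 2 * p) (by omega) (by omega)
      rwa [add_right_comm] at this
  have hafter : ∀ i, t + p ≤ i → g' (i - 2 * p) = g i := by
    intro i hi
    rw [hg']
    dsimp only
    rw [if_neg (by omega), sub_add_cancel]
  have h0 := hg.range t (by omega) (by omega)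
  have hsurj := hwalk.surj_or_end (k := k) (y := g t) (p := p) hε (by omega) h0.1 h0.2
    (fun v hv hvk => by
      obtain ⟨i, hi, hin, rfl⟩ := hg.surj v hv hvk
      by_cases h : i < t - p
      · exact Or.inl ⟨i, hi, by omega, if_pos h⟩
      by_cases h' : t + p ≤ i
      · exact Or.inl ⟨i - 2 * p, by omega, by omega, hafter i h'⟩
      right
      rcases le_total i t with h'' | h''
      · refine ⟨t - i, by omega, by omega, ?_⟩
        rw [← (hleg (t - i) (by omega) (by omega)).1, sub_sub_cancel]
      · refine ⟨i - t, by omega, by omega, ?_⟩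
        rw [← (hleg (i - t) (by omega) (by omega)).2, add_sub_cancel])
    ⟨t + p - 2 * p, by omega, by omega, by
      rw [hafter _ le_rfl, (hleg p (by omega) le_rfl).2]⟩
  refine ⟨g', ?_, ?_, hwalk, ?_⟩
  · intro i hi hin
    rw [hg']
    dsimp only
    split_ifs
    · exact hg.range i hi (by omega)
    · exact hg.range _ (by omega) (by omega)
  · refine hsurj.resolve_right ?_
    rintro ⟨hy, hvis⟩
    by_cases hturn' : IsTurn n g (t + p)
    · obtain ⟨-, -, ε', -, hleg'⟩ := hg.legs hc p hmin hturn'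
      obtain ⟨e1, e2⟩ := hleg' p (by omega) le_rfl
      refine hvis (t + p + p - 2 * p) (by omega) (by omega) ?_
      rw [hafter _ (by omega), e2, ← e1, add_sub_cancel_right]
    · obtain ⟨ε', hε', hst⟩ := hg.straight hc (lo := t) (hi := t + 2 * p) (by omega) htn
        (fun s h1 h2 hs => by
          by_cases h : s = t + p
          · exact hturn' (h ▸ hs)
          · exact hg.not_isTurn_near hc hmin (by omega) (by omega) hpal' (by omega) (by omega)
              h hs)
      have e0 := hst (t + p) (by omega) (by omega)
      have e1 := (hleg p (by omega) le_rfl).2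
      have e2 := hg.range (t + 2 * p) (by omega) htn
      have e3 := hst (t + 2 * p) (by omega) le_rfl
      have hpb := hg.palindromicAt hε' (by omega) (by omega) hpal'
        (fun j h1 h2 => by rw [hst _ (by omega) (by omega), e0]; ring)
      rcases hy with ⟨rfl, hy⟩ | ⟨rfl, hy⟩
      · refine hb.2 p ⟨by omega, Or.inl ⟨?_, ?_⟩⟩
        · rcases hε' with rfl | rfl <;> omega
        · rwa [show g (t + p) = p by omega] at hpb
      · refine hb.2 p ⟨by omega, Or.inr (Or.inl ⟨?_, ?_⟩)⟩
        · rcases hε' with rfl | rfl <;> omega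
        · rwa [show g (t + p) = k - 1 - p by omega] at hpb
  · intro i hi hin
    rw [hg']
    dsimp only
    split_ifs
    · exact hg.label i hi (by omega)
    · exact hg.label _ (by omega) (by omega)

theorem not_hasFold_reverse {B : Type*} {c : ℤ → B} {n r : ℤ} (h : ¬ HasFold c n r) :
    ¬ HasFold (fun i => c (n - 1 - i)) n r := fun h' => h (by simpa using h'.reverse)

theorem not_hasStutter_reverse {B : Type*} {c : ℤ → B} {n : ℤ} (h : ¬ HasStutter c n) :
    ¬ HasStutter (fun i => c (n - 1 - i)) n := fun h' => h (by simpa using h'.reverse)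

theorem IsFolding.collapse_zigzag {B : Type*} {b c : ℤ → B} {k n : ℤ} {g : ℤ → ℤ}
    (hg : IsFolding b k c n g) (hb : FoldFree b k) (hc : ¬ HasStutter c n) {p : ℕ} (hp : 1 ≤ p)
    (hmin : ∀ r : ℤ, r < p → ¬ HasFold c n r) {t : ℤ} (hpt : p ≤ t) (htn : t + 2 * p < n)
    (hpal : PalindromicAt c t p) (hpal' : PalindromicAt c (t + p) p) :
    ∃ g', IsFolding b k (fun i => if i < t - p then c i else c (i + 2 * p)) (n - 2 * p) g' := by
  by_cases hturn : IsTurn n g t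
  · exact hg.collapse_zigzag_of_isTurn hb hc hp hmin htn hpal' hturn
  by_cases hturn' : IsTurn n g (t + p)
  · have hrev : IsTurn n (fun i => g (n - 1 - i)) (n - 1 - (t + p)) := by
      obtain ⟨h1, h2, h3⟩ := hturn'
      refine ⟨by omega, by omega, ?_⟩
      dsimp only
      convert h3.symm using 2 <;> ring
    obtain ⟨g', hg'⟩ := hg.reverse.collapse_zigzag_of_isTurn hb (not_hasStutter_reverse hc) hp
      (fun r hr => not_hasFold_reverse (hmin r hr)) (by omega)
      (by rw [show n - 1 - (t + p) + (p : ℤ) = n - 1 - t by ring]; exact hpal.reverse n) hrev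
    refine ⟨_, { hg'.reverse with label := fun i hi hin => ?_ }⟩
    rw [← hg'.reverse.label i hi hin]
    have per : ∀ i, t - p ≤ i → i ≤ t → c (i + 2 * p) = c i := by
      intro i h1 h2
      have e1 := hpal (t - i) (by omega) (by omega)
      have e2 := hpal' (i - (t - p)) (by omega) (by omega)
      rw [sub_sub_cancel] at e1
      rw [e1, show t + (t - i) = t + p - (i - (t - p)) by ring, e2]
      congr 1; ring
    by_cases h : i < t - p
    · rw [if_pos h, if_neg (by omega)]
      congr 1; ring
    · rw [if_neg h]
      split_ifs with h'
      · congr 1; ring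
      · rw [per i (by omega) (by omega)]
        congr 1; ring
  · exfalso
    obtain ⟨ε, hε, hst⟩ := hg.straight hc (lo := t - p) (hi := t + 2 * p) (by omega) htn
      (fun s h1 h2 hs => by
        rcases lt_or_ge s (t + p) with h | h
        · refine hg.not_isTurn_near hc hmin hpt (by omega) hpal h1 h ?_ hs
          rintro rfl
          exact hturn hs
        · refine hg.not_isTurn_near hc hmin (by omega) (by omega) hpal' (by omega) (by omega) ?_ hs
          rintro rfl
          exact hturn' hs)
    have e0 := hst t (by omega) (by omega)
    have e1 := hst (t + p) (by omega) (by omega)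
    have e2 := hst (t + 2 * p) (by omega) le_rfl
    have r0 := hg.range (t - p) (by omega) (by omega)
    have r1 := hg.range (t + 2 * p) (by omega) htn
    have b1 := hg.palindromicAt hε hpt (by omega) hpal
      (fun j h1 h2 => by rw [hst _ (by omega) (by omega), e0]; ring)
    have b2 := hg.palindromicAt hε (by omega) (by omega) hpal'
      (fun j h1 h2 => by rw [hst _ (by omega) (by omega), e1]; ring)
    refine hb.2 p ⟨by omega, Or.inr (Or.inr ?_)⟩
    rcases hε with rfl | rfl
    · refine ⟨g t, by omega, by omega, b1, ?_⟩
      rwa [show g t + p = g (t + p) by omega]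
    · refine ⟨g (t + p), by omega, by omega, b2, ?_⟩
      rwa [show g (t + p) + p = g t by omega]

/-- A word with a stutter or a fold has the same fold-free generators as some shorter word. -/
theorem exists_shorter_of_not_foldFree {B : Type*} {c : ℤ → B} {n : ℤ} (h : ¬ FoldFree c n) :
    ∃ c' : ℤ → B, ∃ n', 0 < n' ∧ n' < n ∧ ∀ (b : ℤ → B) k g, FoldFree b k →
      IsFolding b k c n g → ∃ g', IsFolding b k c' n' g' := by
  by_cases hc : HasStutter c n
  · obtain ⟨t, ht, htn, heq⟩ := hc
    exact ⟨_, n - 1, by omega, by omega, fun b k g hb hg => hg.collapse_stutter hb ht htn heq⟩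
  have hex : ∃ r : ℕ, HasFold c n r := by
    by_contra! hne
    refine h ⟨hc, fun r hr => hne r.toNat ?_⟩
    rwa [Int.toNat_of_nonneg (by have := hr.1; omega)]
  classical
  obtain ⟨p, hp, hmin⟩ : ∃ p : ℕ, HasFold c n p ∧ ∀ r : ℤ, r < p → ¬ HasFold c n r := by
    refine ⟨Nat.find hex, Nat.find_spec hex, fun r hr hfold => ?_⟩
    refine Nat.find_min hex (m := r.toNat) (by have := hfold.1; omega) ?_
    rwa [Int.toNat_of_nonneg (by have := hfold.1; omega)]
  obtain ⟨h1, ⟨hpn, hpal⟩ | ⟨hpn, hpal⟩ | ⟨t, hpt, htn, hpal, hpal'⟩⟩ := hp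
  · exact ⟨_, n - p, by omega, by omega, fun b k g hb hg =>
      hg.collapse_start hb hc (by omega) hmin hpn hpal⟩
  · refine ⟨_, n - p, by omega, by omega, fun b k g hb hg =>
      hg.reverse.collapse_start hb (not_hasStutter_reverse hc) (by omega)
        (fun r hr => not_hasFold_reverse (hmin r hr)) hpn ?_⟩
    simpa using hpal.reverse n
  · exact ⟨_, n - 2 * p, by omega, by omega, fun b k g hb hg =>
      hg.collapse_zigzag hb hc (by omega) hmin hpt htn hpal hpal'⟩

/-- Fold-free generators of the same word have equal length. -/
theorem foldFree_length_unique {B : Type*} (N : ℕ) : ∀ (c : ℤ → B) (n : ℤ), 0 < n → n ≤ N →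
    ∀ (a b : ℤ → B) (k l : ℤ) (f g : ℤ → ℤ), FoldFree a k → FoldFree b l →
      IsFolding a k c n f → IsFolding b l c n g → k = l := by
  induction N with
  | zero => intro c n h1 h2; push_cast at h2; omega
  | succ N ih =>
    intro c n hn hnN a b k l f g ha hb hf hg
    by_cases hc : FoldFree c n
    · rw [hf.length_eq hn hc, hg.length_eq hn hc]
    · obtain ⟨c', n', h1, h2, hc'⟩ := exists_shorter_of_not_foldFree hc
      obtain ⟨f', hf'⟩ := hc' a k f ha hf
      obtain ⟨g', hg'⟩ := hc' b l g hb hg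
      exact ih c' n' h1 (by push_cast at hnN; omega) a b k l f' g' ha hb hf' hg'

theorem Generates.length_le {A : Type*} {a c : List A} (h : Generates a c) :
    a.length ≤ c.length := by
  obtain ⟨f, -, hf, -⟩ := h
  simpa using Fintype.card_le_of_surjective f hf

theorem Generates.exists_isFolding {A : Type*} {a c : List A} (x : A) (h : Generates a c) :
    ∃ g, IsFolding (fun i => a.getD i.toNat x) a.length (fun i => c.getD i.toNat x) c.length g := by
  obtain ⟨f, hadj, hsurj, hc⟩ := h
  refine ⟨fun i => if h : i.toNat < c.length then (f ⟨i.toNat, h⟩ : ℕ) else 0, ?_, ?_, ?_, ?_⟩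
  · intro i hi hin
    have h : i.toNat < c.length := by omega
    have := (f ⟨i.toNat, h⟩).isLt
    simp only [h, dif_pos]
    omega
  · intro y hy hya
    obtain ⟨i, hi⟩ := hsurj ⟨y.toNat, by omega⟩
    refine ⟨(i : ℕ), by omega, by have := i.isLt; omega, ?_⟩
    simp [hi, hy]
  · intro i hi hin
    have h : i.toNat < c.length := by omega
    have h' : i.toNat + 1 < c.length := by omega
    have := hadj i.toNat h'
    rw [abs_le] at this
    have e : (i + 1).toNat = i.toNat + 1 := by omega
    simp only [h, h', dif_pos, e]
    omega
  · intro i hi hin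
    have h : i.toNat < c.length := by omega
    simp only [h, dif_pos, Int.toNat_natCast]
    rw [List.getD_eq_getElem _ _ h, List.getD_eq_getElem _ _ (f ⟨i.toNat, h⟩).isLt]
    have key : ∀ (l : List A) (hl : i.toNat < l.length), c = l →
        c.get ⟨i.toNat, h⟩ = l.get ⟨i.toNat, hl⟩ := by
      rintro l hl rfl
      rfl
    exact (key _ (by simpa using h) hc).trans (by simp)

theorem IsFolding.generates {A : Type*} {b : List A} {x : A} {d : ℤ → A} {m : ℕ} {g : ℤ → ℤ}
    (hg : IsFolding d m (fun i => b.getD i.toNat x) b.length g) :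
    Generates (List.ofFn fun i : Fin m => d (i : ℕ)) b := by
  have hr : ∀ i : Fin b.length, 0 ≤ g (i : ℕ) ∧ g (i : ℕ) < m := fun i =>
    hg.range _ (by omega) (by have := i.isLt; omega)
  refine ⟨fun i => ⟨(g (i : ℕ)).toNat, by have := hr i; rw [List.length_ofFn]; omega⟩, ?_, ?_, ?_⟩
  · intro i hi
    have h1 := hg.walk i (by omega) (by omega)
    have h2 := hr ⟨i, by omega⟩
    have h3 := hr ⟨i + 1, hi⟩
    push_cast at h2 h3 ⊢
    rw [abs_le]
    omega
  · rintro ⟨y, hy⟩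
    rw [List.length_ofFn] at hy
    obtain ⟨i, hi, hin, hgi⟩ := hg.surj y (by omega) (by omega)
    refine ⟨⟨i.toNat, by omega⟩, ?_⟩
    simp [hi, hgi]
  · refine List.ext_getElem (by simp) fun i h1 h2 => ?_
    have := hg.label i (by omega) (by omega)
    have hri := hr ⟨i, h1⟩
    simp only [Int.toNat_natCast] at this
    rw [List.getD_eq_getElem _ _ h1] at this
    simp [this, hri.1]

theorem Primitive.foldFree {A : Type*} {b : List A} (x : A) (hb : Primitive b) :
    FoldFree (fun i => b.getD i.toNat x) b.length := by
  have key : ¬ ∃ (d : ℤ → A) (m : ℤ) (h : ℤ → ℤ), 0 ≤ m ∧ m < b.length ∧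
      IsFolding d m (fun i => b.getD i.toNat x) b.length h := by
    rintro ⟨d, m, h, hm, hmb, hfold⟩
    lift m to ℕ using hm
    exact hb ⟨_, by rw [List.length_ofFn]; omega, hfold.generates⟩
  exact ⟨fun h => key h.exists_isFolding, fun r h => key h.exists_isFolding⟩

/-- Well-definedness of primitive length: any two primitive generators of the
same word have equal length, and this common length is at most the length of
the word itself. -/
theorem primitive_length_well_defined {A : Type*} :
    (∀ c a b : List A, PrimitiveGenerator a c → PrimitiveGenerator b c →
      a.length = b.length) ∧
    (∀ c a : List A, PrimitiveGenerator a c → a.length ≤ c.length) := by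
  refine ⟨fun c a b ha hb => ?_, fun c a h => h.2.length_le⟩
  rcases c with _ | ⟨x, c⟩
  · have h1 := ha.2.length_le
    have h2 := hb.2.length_le
    simp only [List.length_nil] at h1 h2
    omega
  · obtain ⟨f, hf⟩ := ha.2.exists_isFolding x
    obtain ⟨g, hg⟩ := hb.2.exists_isFolding x
    exact_mod_cast foldFree_length_unique _ _ _ (by simp) le_rfl _ _ _ _ f g
      (ha.1.foldFree x) (hb.1.foldFree x) hf hg
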